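/- Let φ > 0 and consider the time-dependent Hamiltonian on (ℝ²∖{0}) × ℝ² given by H(s, q, p) = (1/2)|p − a(s, q)|², where a(s, q) = (1/2 − φ s/|q|²) q^⊥ and q^⊥ = (−q₂, q₁). Let (q, p) : ℝ → (ℝ²∖{0}) × ℝ² be a global differentiable solution of Hamilton's equations q′(s) = ∇_p H(s, q(s), p(s)), p′(s) = −∇_q H(s, q(s), p(s)), and let E(s) = (1/2)|p(s) − a(s, q(s))|² be its energy. Then E(s)/|s| → φ as s → −∞; i.e., in the past the energy grows linearly at asymptotic rate φ. -/

import Mathlib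

open MeasureTheory Filter Topology

noncomputable section

/-- The plane `ℝ²` with its Euclidean inner product structure. -/
abbrev Plane : Type := EuclideanSpace ℝ (Fin 2)

/-- Rotation by `π/2`: `q^⊥ = (-q₂, q₁)`. -/
def perp (q : Plane) : Plane := !₂[-(q 1), q 0]

/-- The time-dependent vector potential `a(s,q) = (1/2 - φ s / |q|²) q^⊥`. -/
def vecPot (φ s : ℝ) (q : Plane) : Plane := ((1 : ℝ)/2 - φ * s / ‖q‖^2) • perp q

/-- The time-dependent Hamiltonian `H(s,q,p) = (1/2)|p - a(s,q)|²`. -/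
def Ham (φ s : ℝ) (q p : Plane) : ℝ := (1/2) * ‖p - vecPot φ s q‖^2

/-- Hamilton's equations `q' = ∇_p H`, `p' = -∇_q H` hold at time `s`. -/
def HamiltonEqnsAt (φ : ℝ) (q p : ℝ → Plane) (s : ℝ) : Prop :=
  HasDerivAt q (gradient (fun y => Ham φ s (q s) y) (p s)) s ∧
    HasDerivAt p (-(gradient (fun x => Ham φ s x (p s)) (q s))) s

/-- Newton form: the energy asymptotics in real coordinates. -/
theorem newton_growth (φ : ℝ) (hφ : 0 < φ) (x y u w : ℝ → ℝ)
    (hρ : ∀ s, 0 < x s ^ 2 + y s ^ 2)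
    (hx : ∀ s, HasDerivAt x (u s) s) (hy : ∀ s, HasDerivAt y (w s) s)
    (hu : ∀ s, HasDerivAt u (w s - φ * y s / (x s ^ 2 + y s ^ 2)) s)
    (hw : ∀ s, HasDerivAt w (-u s + φ * x s / (x s ^ 2 + y s ^ 2)) s) :
    Tendsto (fun s => ((1/2) * (u s ^ 2 + w s ^ 2)) / |s|) atBot (𝓝 φ) := by
  -- conserved canonical angular momentum
  obtain ⟨c, hc⟩ : ∃ c, ∀ s, x s * w s - y s * u s + (x s ^ 2 + y s ^ 2) / 2 = c + φ * s := by
    have hd : ∀ s, HasDerivAt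
        (fun s => x s * w s - y s * u s + (x s ^ 2 + y s ^ 2) / 2 - φ * s) 0 s := by
      intro s
      have h := (((((hx s).mul (hw s)).sub ((hy s).mul (hu s))).add
        ((((hx s).pow 2).add ((hy s).pow 2)).div_const 2)).sub
        ((hasDerivAt_id s).const_mul φ))
      refine h.congr_deriv ?_
      have := (hρ s).ne'
      field_simp
      ring
    refine ⟨x 0 * w 0 - y 0 * u 0 + (x 0 ^ 2 + y 0 ^ 2) / 2 - φ * 0, fun s => ?_⟩
    have := is_const_of_deriv_eq_zero (fun s => (hd s).differentiableAt)
      (fun s => (hd s).deriv) s 0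
    linarith
  have hl : ∀ s, c + φ * s < 0 → x s * w s - y s * u s < 0 := by
    intro s hs
    have := hc s
    have := hρ s
    linarith
  set G : ℝ → ℝ := fun s => (1/2) * (u s ^ 2 + w s ^ 2) + φ * s
    - φ * Real.arctan ((x s * u s + y s * w s) / (x s * w s - y s * u s)) with hG
  set g : ℝ → ℝ := fun s => φ ^ 2 * (x s * u s + y s * w s) /
    ((x s * w s - y s * u s) ^ 2 + (x s * u s + y s * w s) ^ 2) with hg
  have hGd : ∀ s, c + φ * s < 0 → HasDerivAt G (g s) s := by
    intro s hs
    have hl' := (hl s hs).ne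
    have hr := hρ s
    have hm : HasDerivAt (fun s => x s * u s + y s * w s)
        ((u s ^ 2 + w s ^ 2) + (x s * w s - y s * u s)) s := by
      refine (((hx s).mul (hu s)).add ((hy s).mul (hw s))).congr_deriv ?_
      field_simp
      ring
    have hld : HasDerivAt (fun s => x s * w s - y s * u s)
        (φ - (x s * u s + y s * w s)) s := by
      refine (((hx s).mul (hw s)).sub ((hy s).mul (hu s))).congr_deriv ?_
      field_simp
      ring
    have hEd : HasDerivAt (fun s => (1/2) * (u s ^ 2 + w s ^ 2))
        (φ * (x s * w s - y s * u s) / (x s ^ 2 + y s ^ 2)) s := by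
      refine ((((hu s).pow 2).add ((hw s).pow 2)).const_mul (1/2 : ℝ)).congr_deriv ?_
      field_simp
      ring
    have h := (hEd.add ((hasDerivAt_id s).const_mul φ)).sub
      ((hm.div hld hl').arctan.const_mul φ)
    refine h.congr_deriv ?_
    have hE : (x s * w s - y s * u s) ^ 2 + (x s * u s + y s * w s) ^ 2
      = (x s ^ 2 + y s ^ 2) * (u s ^ 2 + w s ^ 2) := by ring
    simp only [hg, Pi.div_apply]
    generalize x s * w s - y s * u s = l at *
    generalize x s * u s + y s * w s = m at *
    generalize x s ^ 2 + y s ^ 2 = r at *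
    generalize u s ^ 2 + w s ^ 2 = V at *
    have hS : 0 < l ^ 2 + m ^ 2 := by positivity
    have h3 : 1 + (m / l) ^ 2 = (l ^ 2 + m ^ 2) / l ^ 2 := by field_simp
    rw [h3]
    field_simp
    linear_combination l * hE
  have hgb : ∀ s, c + φ * s < 0 → |g s| ≤ φ * (φ / (-(c + φ * s))) := by
    intro s hs
    have hl' := hl s hs
    set l := x s * w s - y s * u s with hldef
    set m := x s * u s + y s * w s
    have hD : -(c + φ * s) ≤ -l := by
      have := hc s
      have := hρ s
      linarith
    have hpos : 0 < -(c + φ * s) := by linarith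
    have hS : 0 < l ^ 2 + m ^ 2 := by nlinarith [sq_nonneg m]
    simp only [hg]
    rw [abs_div, abs_of_pos hS, ← mul_div_assoc, div_le_div_iff₀ hS hpos, abs_mul,
      abs_of_pos (by positivity : 0 < φ ^ 2)]
    have hm : |m| * -(c + φ * s) ≤ l ^ 2 + m ^ 2 := by
      have h0 := abs_nonneg m
      have : |m| * -(c + φ * s) ≤ |m| * -l := by gcongr
      nlinarith [sq_abs m, sq_nonneg (|m| + l)]
    have : 0 < φ ^ 2 := by positivity
    nlinarith
  -- comparison with log
  set s₀ : ℝ := min (-1) ((-1 - c) / φ) with hs0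
  have hneg : ∀ s, s ≤ s₀ → c + φ * s ≤ -1 := by
    intro s hs
    have : s ≤ (-1 - c) / φ := hs.trans (min_le_right _ _)
    rw [le_div_iff₀ hφ] at this
    linarith
  have hlog : ∀ s, s ≤ s₀ → HasDerivAt (fun s => φ * Real.log (-(c + φ * s)))
      (- (φ * (φ / (-(c + φ * s))))) s := by
    intro s hs
    have h0 := hneg s hs
    have h : HasDerivAt (fun s => -(c + φ * s)) (-φ) s := by
      have := (((hasDerivAt_id s).const_mul φ).const_add c).neg
      rw [mul_one] at this
      exact this
    refine ((h.log (by linarith)).const_mul φ).congr_deriv ?_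
    ring
  have hanti : AntitoneOn (fun s => G s + φ * Real.log (-(c + φ * s))) (Set.Iic s₀) := by
    refine antitoneOn_of_hasDerivWithinAt_nonpos (convex_Iic _)
      (f' := fun s => g s + - (φ * (φ / (-(c + φ * s))))) ?_ ?_ ?_
    · intro s hs
      exact ((hGd s (by linarith [hneg s hs])).add (hlog s hs)).continuousAt.continuousWithinAt
    · intro s hs
      rw [interior_Iic] at hs
      exact ((hGd s (by linarith [hneg s hs.le])).add (hlog s hs.le)).hasDerivWithinAt
    · intro s hs
      rw [interior_Iic] at hs
      have := (abs_le.1 (hgb s (by linarith [hneg s hs.le]))).2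
      linarith
  have hmono : MonotoneOn (fun s => G s - φ * Real.log (-(c + φ * s))) (Set.Iic s₀) := by
    refine monotoneOn_of_hasDerivWithinAt_nonneg (convex_Iic _)
      (f' := fun s => g s - - (φ * (φ / (-(c + φ * s))))) ?_ ?_ ?_
    · intro s hs
      exact ((hGd s (by linarith [hneg s hs])).sub (hlog s hs)).continuousAt.continuousWithinAt
    · intro s hs
      rw [interior_Iic] at hs
      exact ((hGd s (by linarith [hneg s hs.le])).sub (hlog s hs.le)).hasDerivWithinAt
    · intro s hs
      rw [interior_Iic] at hs
      have := (abs_le.1 (hgb s (by linarith [hneg s hs.le]))).1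
      linarith
  have hT : Tendsto (fun s : ℝ => -(c + φ * s)) atBot atTop :=
    tendsto_neg_atBot_atTop.comp
      (tendsto_atBot_add_const_left _ c (tendsto_id.const_mul_atBot hφ))
  have hlogT : Tendsto (fun s : ℝ => Real.log (-(c + φ * s)) / (-(c + φ * s))) atBot (𝓝 0) :=
    (Real.isLittleO_log_id_atTop.tendsto_div_nhds_zero).comp hT
  have hinv : Tendsto (fun s : ℝ => s⁻¹) atBot (𝓝 0) := tendsto_inv_atBot_zero
  set K : ℝ := |G s₀| + φ * |Real.log (-(c + φ * s₀))| + φ * (Real.pi / 2) with hK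
  have hB : Tendsto (fun s : ℝ => -K * s⁻¹ +
      φ * (Real.log (-(c + φ * s)) / (-(c + φ * s))) * (φ + c * s⁻¹)) atBot (𝓝 0) := by
    have := (hinv.const_mul (-K)).add ((hlogT.const_mul φ).mul ((hinv.const_mul c).const_add φ))
    simpa using this
  rw [tendsto_iff_norm_sub_tendsto_zero]
  refine squeeze_zero' (Eventually.of_forall fun s => norm_nonneg _) ?_ hB
  filter_upwards [eventually_le_atBot s₀] with s hs
  have hs1 : s ≤ -1 := hs.trans (min_le_left _ _)
  have hD := hneg s hs
  have ha := hanti (Set.mem_Iic.2 hs) (Set.mem_Iic.2 (le_refl s₀)) hs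
  have hb := hmono (Set.mem_Iic.2 hs) (Set.mem_Iic.2 (le_refl s₀)) hs
  simp only at ha hb
  have hat1 := Real.arctan_lt_pi_div_two ((x s * u s + y s * w s) / (x s * w s - y s * u s))
  have hat2 := Real.neg_pi_div_two_lt_arctan ((x s * u s + y s * w s) / (x s * w s - y s * u s))
  have hGs : G s = (1/2) * (u s ^ 2 + w s ^ 2) + φ * s
    - φ * Real.arctan ((x s * u s + y s * w s) / (x s * w s - y s * u s)) := rfl
  generalize Real.arctan ((x s * u s + y s * w s) / (x s * w s - y s * u s)) = ang at *
  generalize (1/2) * (u s ^ 2 + w s ^ 2) = e at *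
  have hrhs : -K * s⁻¹ + φ * (Real.log (-(c + φ * s)) / (-(c + φ * s))) * (φ + c * s⁻¹)
      = (K + φ * Real.log (-(c + φ * s))) / (-s) := by
    have h1 : s ≠ 0 := by linarith
    have h2 : c + φ * s ≠ 0 := by linarith
    have h4 : φ + c * s⁻¹ = (c + φ * s) * s⁻¹ := by field_simp; ring
    rw [h4]
    generalize Real.log (-(c + φ * s)) = L
    generalize c + φ * s = T at h2
    field_simp
    ring
  have hlhs : e / |s| - φ = (e + φ * s) / (-s) := by
    rw [abs_of_neg (by linarith)]
    have h1 : s ≠ 0 := by linarith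
    field_simp
    ring
  rw [hrhs, hlhs, Real.norm_eq_abs, abs_div, abs_of_pos (show 0 < -s by linarith)]
  have hsp : 0 < -s := by linarith
  gcongr
  have hp1 : φ * ang ≤ φ * (Real.pi / 2) := by gcongr
  have hp2 : φ * (-(Real.pi / 2)) ≤ φ * ang := by gcongr
  have hp3 : φ * Real.log (-(c + φ * s₀)) ≤ φ * |Real.log (-(c + φ * s₀))| := by
    gcongr; exact le_abs_self _
  have hp4 : φ * -|Real.log (-(c + φ * s₀))| ≤ φ * Real.log (-(c + φ * s₀)) := by
    gcongr; exact neg_abs_le _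
  have hp5 := le_abs_self (G s₀)
  have hp6 := neg_abs_le (G s₀)
  rw [abs_le]
  constructor <;> linarith


theorem gradient_coord {f : Plane → ℝ} {L : Plane →L[ℝ] ℝ} {x : Plane}
    (h : HasFDerivAt f L x) (i : Fin 2) :
    gradient f x i = L (EuclideanSpace.single i 1) := by
  have h1 : inner ℝ (gradient f x) (EuclideanSpace.single i (1 : ℝ))
      = L (EuclideanSpace.single i 1) := by
    rw [gradient, InnerProductSpace.toDual_symm_apply, h.fderiv]
  rw [← h1, EuclideanSpace.inner_single_right]
  simp

theorem normSq_plane (x : Plane) : ‖x‖ ^ 2 = x 0 ^ 2 + x 1 ^ 2 := by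
  rw [EuclideanSpace.real_norm_sq_eq, Fin.sum_univ_two]

theorem ham_formula (φ s : ℝ) (x p : Plane) : Ham φ s x p =
    (1/2) * ((p 0 + (1/2 - φ * s / (x 0 ^ 2 + x 1 ^ 2)) * x 1) ^ 2 +
      (p 1 - (1/2 - φ * s / (x 0 ^ 2 + x 1 ^ 2)) * x 0) ^ 2) := by
  simp only [Ham, normSq_plane, vecPot, perp]
  simp

theorem coord_fderiv (i : Fin 2) (x : Plane) :
    HasFDerivAt (fun y : Plane => y i) (EuclideanSpace.proj i : Plane →L[ℝ] ℝ) x :=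
  (EuclideanSpace.proj i : Plane →L[ℝ] ℝ).hasFDerivAt

theorem grad_p (φ s : ℝ) (x p : Plane) :
    gradient (fun y => Ham φ s x y) p 0 = p 0 + (1/2 - φ * s / (x 0 ^ 2 + x 1 ^ 2)) * x 1 ∧
    gradient (fun y => Ham φ s x y) p 1 = p 1 - (1/2 - φ * s / (x 0 ^ 2 + x 1 ^ 2)) * x 0 := by
  simp only [ham_formula]
  have h := (((((coord_fderiv 0 p).add_const
      ((1/2 - φ * s / (x 0 ^ 2 + x 1 ^ 2)) * x 1)).pow 2).add
    (((coord_fderiv 1 p).sub_const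
      ((1/2 - φ * s / (x 0 ^ 2 + x 1 ^ 2)) * x 0)).pow 2)).const_mul (1/2 : ℝ))
  constructor
  · refine (gradient_coord h 0).trans ?_
    simp
    ring
  · refine (gradient_coord h 1).trans ?_
    simp

theorem grad_q (φ s : ℝ) (x p : Plane) (hx : 0 < x 0 ^ 2 + x 1 ^ 2) :
    gradient (fun y => Ham φ s y p) x 0 =
      (p 0 + (1/2 - φ * s / (x 0 ^ 2 + x 1 ^ 2)) * x 1) *
        (x 1 * (2 * φ * s * x 0 / (x 0 ^ 2 + x 1 ^ 2) ^ 2)) -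
      (p 1 - (1/2 - φ * s / (x 0 ^ 2 + x 1 ^ 2)) * x 0) *
        ((1/2 - φ * s / (x 0 ^ 2 + x 1 ^ 2)) +
          x 0 * (2 * φ * s * x 0 / (x 0 ^ 2 + x 1 ^ 2) ^ 2)) ∧
    gradient (fun y => Ham φ s y p) x 1 =
      (p 0 + (1/2 - φ * s / (x 0 ^ 2 + x 1 ^ 2)) * x 1) *
        ((1/2 - φ * s / (x 0 ^ 2 + x 1 ^ 2)) +
          x 1 * (2 * φ * s * x 1 / (x 0 ^ 2 + x 1 ^ 2) ^ 2)) -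
      (p 1 - (1/2 - φ * s / (x 0 ^ 2 + x 1 ^ 2)) * x 0) *
        (x 0 * (2 * φ * s * x 1 / (x 0 ^ 2 + x 1 ^ 2) ^ 2)) := by
  simp only [ham_formula]
  have hr := ((coord_fderiv 0 x).pow 2).add ((coord_fderiv 1 x).pow 2)
  have hi := (hasDerivAt_inv hx.ne').comp_hasFDerivAt x hr
  have hb := (hi.const_mul (φ * s)).const_sub (1/2 : ℝ)
  have h := ((((hb.mul (coord_fderiv 1 x)).const_add (p 0)).pow 2).add
    (((hb.mul (coord_fderiv 0 x)).const_sub (p 1)).pow 2)).const_mul (1/2 : ℝ)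
  constructor
  · refine (gradient_coord h 0).trans ?_
    simp
    field_simp
    ring
  · refine (gradient_coord h 1).trans ?_
    simp
    field_simp
    ring

/-- Along any global solution of Hamilton's equations, the energy
grows linearly in the past: `E(s)/|s| → φ` as `s → -∞`. -/
theorem energy_linear_growth_past (φ : ℝ) (hφ : 0 < φ)
    (q p : ℝ → Plane)
    (hq0 : ∀ s, q s ≠ 0)
    (hham : ∀ s, HamiltonEqnsAt φ q p s)
    (E : ℝ → ℝ) (hE : ∀ s, E s = (1/2) * ‖p s - vecPot φ s (q s)‖^2) :
    Tendsto (fun s => E s / |s|) atBot (𝓝 φ) := by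
  have hρ : ∀ s, 0 < q s 0 ^ 2 + q s 1 ^ 2 := by
    intro s
    rw [← normSq_plane]
    have := norm_pos_iff.2 (hq0 s)
    positivity
  have hcoord : ∀ (f : ℝ → Plane) (f' : Plane) (s : ℝ) (i : Fin 2),
      HasDerivAt f f' s → HasDerivAt (fun t => f t i) (f' i) s := by
    intro f f' s i h
    exact (coord_fderiv i (f s)).comp_hasDerivAt s h
  have hq := fun s i => hcoord _ _ s i (hham s).1
  have hp := fun s i => hcoord _ _ s i (hham s).2
  have hq0' := fun s => (hq s 0).congr_deriv (grad_p φ s (q s) (p s)).1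
  have hq1' := fun s => (hq s 1).congr_deriv (grad_p φ s (q s) (p s)).2
  have hp0' := fun s => (hp s 0).congr_deriv
    (congrArg Neg.neg (grad_q φ s (q s) (p s) (hρ s)).1)
  have hp1' := fun s => (hp s 1).congr_deriv
    (congrArg Neg.neg (grad_q φ s (q s) (p s) (hρ s)).2)
  have hb := fun s => (((hasDerivAt_id s).const_mul φ).div
    (((hq0' s).pow 2).add ((hq1' s).pow 2)) (hρ s).ne').const_sub (1/2 : ℝ)
  have key := newton_growth φ hφ (fun s => q s 0) (fun s => q s 1)
    (fun s => p s 0 + (1/2 - φ * s / (q s 0 ^ 2 + q s 1 ^ 2)) * q s 1)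
    (fun s => p s 1 - (1/2 - φ * s / (q s 0 ^ 2 + q s 1 ^ 2)) * q s 0)
    hρ hq0' hq1' ?_ ?_
  · refine key.congr fun s => ?_
    rw [hE s, ← ham_formula]
    rfl
  · intro s
    refine ((hp0' s).add ((hb s).mul (hq1' s))).congr_deriv ?_
    have := hρ s
    simp
    field_simp
    ring
  · intro s
    refine ((hp1' s).sub ((hb s).mul (hq0' s))).congr_deriv ?_
    have := hρ s
    simp
    field_simp
    ring
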